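/- Any flat virtual knot can be deformed into the trivial flat virtual knot (represented by the chordless flat Gauss diagram) by a finite sequence of flat Ξ-moves and flat Reidemeister moves; that is, the flat Ξ-move is an unknotting operation for flat virtual knots. -/

import Mathlib

/-!
Flat Gauss diagrams: a flat Gauss diagram is encoded as the list of its chord
endpoint labels read along the oriented circle (chords are unsigned and
unoriented).  The flat Reidemeister moves and the flat Ξ-move are the usual
moves on Gauss diagrams with the signs and orientations of chords forgotten.
-/

namespace FlatGauss

/-- A word is a flat Gauss diagram when every chord label occurring in it
occurs exactly twice. -/
def IsFlatGaussDiagram (L : List ℕ) : Prop :=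
  ∀ c ∈ L, (L.filter (fun x => x == c)).length = 2

/-- Moving the basepoint of the circle. -/
def rotateStep (L L' : List ℕ) : Prop :=
  ∃ x xs, L = x :: xs ∧ L' = xs ++ [x]

/-- Injective relabeling of the chords. -/
def relabelStep (L L' : List ℕ) : Prop :=
  ∃ f : ℕ → ℕ, Function.Injective f ∧ L' = L.map f

/-- Flat Reidemeister move I (removal direction). -/
def reid1 (L L' : List ℕ) : Prop :=
  ∃ (A B : List ℕ) (c : ℕ),
    c ∉ A ++ B ∧ L = A ++ [c, c] ++ B ∧ L' = A ++ B

/-- Flat Reidemeister move II (removal direction). -/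
def reid2 (L L' : List ℕ) : Prop :=
  ∃ (A B C : List ℕ) (c d : ℕ) (crossed : Bool),
    c ≠ d ∧ c ∉ A ++ B ++ C ∧ d ∉ A ++ B ++ C ∧
    L = A ++ [c, d] ++ B ++ (if crossed then [c, d] else [d, c]) ++ C ∧
    L' = A ++ B ++ C

/-- Flat Reidemeister move III (a standard variant; together with the other
flat moves it generates all versions of the flat third move). -/
def reid3 (L L' : List ℕ) : Prop :=
  ∃ (A B C D : List ℕ) (a b c : ℕ),
    a ≠ b ∧ b ≠ c ∧ a ≠ c ∧
    L = A ++ [b, a] ++ B ++ [a, c] ++ C ++ [b, c] ++ D ∧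
    L' = A ++ [a, b] ++ B ++ [c, a] ++ C ++ [c, b] ++ D

/-- A single flat Reidemeister generator (including diagram renamings). -/
def reidStep (L L' : List ℕ) : Prop :=
  rotateStep L L' ∨ relabelStep L L' ∨ reid1 L L' ∨ reid2 L L' ∨ reid3 L L'

/-- A flat Ξ-move: exchange the first and third of three consecutive endpoints
belonging to three distinct chords. -/
def xiStep (L L' : List ℕ) : Prop :=
  ∃ (A B : List ℕ) (x y z : ℕ),
    x ≠ y ∧ y ≠ z ∧ x ≠ z ∧
    L = A ++ [x, y, z] ++ B ∧ L' = A ++ [z, y, x] ++ B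

/-- Finite sequences of moves from `r`, performed in either direction. -/
def Moves (r : List ℕ → List ℕ → Prop) : List ℕ → List ℕ → Prop :=
  Relation.ReflTransGen (fun L L' => r L L' ∨ r L' L)

/-- Related by a finite sequence of flat Ξ-moves and flat Reidemeister moves. -/
def RelXi : List ℕ → List ℕ → Prop :=
  Moves (fun L L' => reidStep L L' ∨ xiStep L L')

end FlatGauss

namespace FlatGauss

/-- Flatness in terms of `List.count`. -/
lemma flat_iff (L : List ℕ) : IsFlatGaussDiagram L ↔ ∀ c, L.count c = 0 ∨ L.count c = 2 := by
  have key : ∀ c, (L.filter (fun x => x == c)).length = L.count c := by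
    intro c
    rw [List.count_eq_length_filter]
  constructor
  · intro h c
    by_cases hc : c ∈ L
    · right; rw [← key]; exact h c hc
    · left; exact List.count_eq_zero.2 hc
  · intro h c hc
    rw [key]
    rcases h c with h | h
    · exact absurd hc (List.count_eq_zero.1 h)
    · exact h

lemma flat_perm {L L' : List ℕ} (h : L.Perm L') (hL : IsFlatGaussDiagram L) :
    IsFlatGaussDiagram L' := by
  rw [flat_iff] at *
  intro c
  rw [← h.count_eq]
  exact hL c

/-- `L` is deformable into a strictly shorter diagram. -/
def Red (L : List ℕ) : Prop :=
  ∃ L', IsFlatGaussDiagram L' ∧ L'.length < L.length ∧ RelXi L L'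

lemma Red.step {L M : List ℕ} (hM : Red M) (hl : M.length = L.length) (h : RelXi L M) : Red L := by
  obtain ⟨L', h1, h2, h3⟩ := hM
  exact ⟨L', h1, by omega, Relation.ReflTransGen.trans h h3⟩

lemma red_r1 {P B : List ℕ} {c : ℕ} (h : IsFlatGaussDiagram (P ++ c :: c :: B)) :
    Red (P ++ c :: c :: B) := by
  rw [flat_iff] at h
  refine ⟨P ++ B, ?_, by simp, Relation.ReflTransGen.single (Or.inl (Or.inl ?_))⟩
  · rw [flat_iff]
    intro d
    have := h d
    have h2 := h c
    simp only [List.count_append, List.count_cons] at *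
    grind
  · refine Or.inr (Or.inr (Or.inl ⟨P, B, c, ?_, by simp, rfl⟩))
    rw [← List.count_eq_zero]
    have := h c
    simp only [List.count_append, List.count_cons] at *
    grind

lemma red_r2 {P B : List ℕ} {c d : ℕ} (hcd : c ≠ d)
    (h : IsFlatGaussDiagram (P ++ c :: d :: c :: d :: B)) :
    Red (P ++ c :: d :: c :: d :: B) := by
  rw [flat_iff] at h
  have hc : (P ++ B).count c = 0 := by
    have := h c
    simp only [List.count_append, List.count_cons] at *
    grind
  have hd : (P ++ B).count d = 0 := by
    have := h d
    simp only [List.count_append, List.count_cons] at *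
    grind
  refine ⟨P ++ B, ?_, by simp; omega, Relation.ReflTransGen.single (Or.inl (Or.inl ?_))⟩
  · rw [flat_iff]
    intro e
    have := h e
    simp only [List.count_append, List.count_cons] at *
    grind
  · refine Or.inr (Or.inr (Or.inr (Or.inl ⟨P, [], B, c, d, true, hcd, ?_, ?_, by simp, by simp⟩)))
    · simpa using List.count_eq_zero.1 hc
    · simpa using List.count_eq_zero.1 hd

lemma red_xi {P B : List ℕ} {x y z : ℕ} (hxy : x ≠ y) (hyz : y ≠ z) (hxz : x ≠ z)
    (h : Red (P ++ z :: y :: x :: B)) : Red (P ++ x :: y :: z :: B) :=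
  h.step (by simp) (Relation.ReflTransGen.single
    (Or.inl (Or.inr ⟨P, B, x, y, z, hxy, hyz, hxz, by simp, by simp⟩)))

lemma red_rot (A : List ℕ) : ∀ B, Red (B ++ A) → Red (A ++ B) := by
  induction A with
  | nil => intro B h; simpa using h
  | cons a A ih =>
    intro B h
    have h1 : Red (A ++ (B ++ [a])) := ih _ (by simpa using h)
    refine h1.step (by simp; omega) (Relation.ReflTransGen.single
      (Or.inl (Or.inl (Or.inl ⟨a, A ++ B, by simp, by simp⟩))))

lemma flat_xi {P B : List ℕ} {x y z : ℕ} (h : IsFlatGaussDiagram (P ++ x :: y :: z :: B)) :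
    IsFlatGaussDiagram (P ++ z :: y :: x :: B) := by
  rw [flat_iff] at *
  intro c
  have := h c
  simp only [List.count_append, List.count_cons] at *
  omega

/-- Moving the near endpoint of a chord two steps towards the far one. -/
lemma red_push {P A B : List ℕ} {c x y : ℕ}
    (h : IsFlatGaussDiagram (P ++ c :: x :: y :: (A ++ c :: B)))
    (ih : IsFlatGaussDiagram ((P ++ [y, x]) ++ c :: (A ++ c :: B)) →
      Red ((P ++ [y, x]) ++ c :: (A ++ c :: B))) :
    Red (P ++ c :: x :: y :: (A ++ c :: B)) := by
  by_cases hxy : x = y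
  · subst hxy
    have := @red_r1 (P ++ [c]) (A ++ c :: B) x (by simpa using h)
    simpa using this
  · have hc : c ≠ x ∧ c ≠ y := by
      have := (flat_iff _).1 h c
      simp only [List.count_append, List.count_cons] at this
      grind
    refine red_xi hc.1 hxy hc.2 ?_
    have := ih (by simpa using flat_xi h)
    simpa using this

lemma red_even (n : ℕ) : ∀ (P A B : List ℕ) (c : ℕ), A.length = 2 * n →
    IsFlatGaussDiagram (P ++ c :: (A ++ c :: B)) → Red (P ++ c :: (A ++ c :: B)) := by
  induction n with
  | zero =>
    intro P A B c hA h
    obtain rfl : A = [] := List.length_eq_zero_iff.1 (by omega)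
    exact red_r1 h
  | succ n ih =>
    intro P A B c hA h
    match A, hA with
    | x :: y :: A, hA =>
      exact red_push h (ih _ _ _ _ (by simp at hA; omega))

lemma red_cxcx (n : ℕ) : ∀ (S T : List ℕ) (c x : ℕ), c ≠ x → S.length = 2 * n →
    IsFlatGaussDiagram (c :: x :: c :: (S ++ x :: T)) → Red (c :: x :: c :: (S ++ x :: T)) := by
  induction n with
  | zero =>
    intro S T c x hcx hS h
    obtain rfl : S = [] := List.length_eq_zero_iff.1 (by omega)
    exact @red_r2 [] T c x hcx h
  | succ n ih =>
    intro S T c x hcx hS h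
    obtain ⟨S', z, rfl⟩ : ∃ S' z, S = S' ++ [z] :=
      ⟨_, _, (List.dropLast_append_getLast (l := S) (by rintro rfl; simp at hS)).symm⟩
    obtain ⟨S, y, rfl⟩ : ∃ S y, S' = S ++ [y] :=
      ⟨_, _, (List.dropLast_append_getLast (l := S') (by rintro rfl; simp at hS; omega)).symm⟩
    by_cases hyz : y = z
    · subst hyz
      have := @red_r1 (c :: x :: c :: S) (x :: T) y (by simpa using h)
      simpa using this
    · have hx : y ≠ x ∧ z ≠ x := by
        have := (flat_iff _).1 h x
        simp only [List.count_append, List.count_cons] at this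
        grind
      have h' : IsFlatGaussDiagram ((c :: x :: c :: S) ++ y :: z :: x :: T) := by simpa using h
      have := @red_xi (c :: x :: c :: S) T y z x hyz hx.2 hx.1 (by
        have := ih S (z :: y :: T) c x hcx (by simp at hS; omega) (by simpa using flat_xi h')
        simpa using this)
      simpa using this

lemma red_cxc {P B : List ℕ} {c x : ℕ} (h : IsFlatGaussDiagram (P ++ c :: x :: c :: B)) :
    Red (P ++ c :: x :: c :: B) := by
  apply red_rot
  have hR : IsFlatGaussDiagram (c :: x :: c :: (B ++ P)) := by
    have := flat_perm List.perm_append_comm h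
    simpa using this
  change Red (c :: x :: c :: (B ++ P))
  generalize B ++ P = R at hR
  have hcx : c ≠ x := by
    rintro rfl
    have := (flat_iff _).1 hR c
    simp only [List.count_cons] at this
    grind
  have hx : x ∈ R := by
    by_contra hx
    have h0 := List.count_eq_zero.2 hx
    have := (flat_iff _).1 hR x
    simp only [List.count_cons] at this
    grind
  obtain ⟨S, T, rfl⟩ := List.append_of_mem hx
  rcases Nat.even_or_odd' S.length with ⟨n, hn | hn⟩
  · exact red_cxcx n S T c x hcx hn hR
  · exact red_even (n + 1) [c] (c :: S) T x (by simp; omega) hR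

lemma red_odd (n : ℕ) : ∀ (P A B : List ℕ) (c : ℕ), A.length = 2 * n + 1 →
    IsFlatGaussDiagram (P ++ c :: (A ++ c :: B)) → Red (P ++ c :: (A ++ c :: B)) := by
  induction n with
  | zero =>
    intro P A B c hA h
    obtain ⟨x, rfl⟩ := List.length_eq_one_iff.1 hA
    exact red_cxc h
  | succ n ih =>
    intro P A B c hA h
    match A, hA with
    | x :: y :: A, hA =>
      exact red_push h (ih _ _ _ _ (by simp at hA; omega))

lemma red_of_ne_nil {L : List ℕ} (h : IsFlatGaussDiagram L) (hL : L ≠ []) : Red L := by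
  obtain ⟨c, R, rfl⟩ := List.exists_cons_of_ne_nil hL
  have hc : c ∈ R := by
    by_contra hc
    have h0 := List.count_eq_zero.2 hc
    have := (flat_iff _).1 h c
    simp only [List.count_cons] at this
    grind
  obtain ⟨A, B, rfl⟩ := List.append_of_mem hc
  rcases Nat.even_or_odd' A.length with ⟨n, hn | hn⟩
  · exact red_even n [] A B c hn h
  · exact red_odd n [] A B c hn h

lemma unknot_aux (n : ℕ) : ∀ L : List ℕ, L.length ≤ n → IsFlatGaussDiagram L → RelXi L [] := by
  induction n with
  | zero =>
    intro L hn _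
    obtain rfl : L = [] := List.length_eq_zero_iff.1 (by omega)
    exact Relation.ReflTransGen.refl
  | succ n ih =>
    intro L hn h
    by_cases hL : L = []
    · subst hL; exact Relation.ReflTransGen.refl
    · obtain ⟨L', h1, h2, h3⟩ := red_of_ne_nil h hL
      exact Relation.ReflTransGen.trans h3 (ih L' (by omega) h1)

end FlatGauss

open FlatGauss in
/-- the flat Ξ-move is an unknotting operation for flat virtual
knots: any flat Gauss diagram can be deformed into the chordless one by a
finite sequence of flat Ξ-moves and flat Reidemeister moves. -/
theorem flat_xi_unknotting (L : List ℕ) (hL : IsFlatGaussDiagram L) :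
    RelXi L [] := by
  exact unknot_aux L.length L le_rfl hL
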